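/- Signed Minkowski–Weyl theorem, exterior direction: for every finite set V ⊂ 𝕋±^d there exist finitely many vectors a⁽¹⁾,…,a⁽ᵐ⁾ ∈ 𝕋±^{d+1} such that tconv(V) equals the intersection of the closed signed tropical halfspaces H̄⁺(a⁽¹⁾), …, H̄⁺(a⁽ᵐ⁾). -/

import Mathlib

/-!  Signed tropical numbers 𝕋±, the symmetrized tropical semiring 𝕊,
     and signed tropical convexity (Loho–Végh). -/

inductive SSign : Type where
  | pos : SSign
  | neg : SSign
  | bal : SSign
deriving DecidableEq

/-- The symmetrized tropical semiring 𝕊: the tropical zero 𝟘 = -∞ together with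
elements `elem s r` where `s` is a sign (⊕, ⊖ or •) and `r` a real number. -/
inductive STrop : Type where
  | zero : STrop
  | elem : SSign → ℝ → STrop

namespace STrop

/-- membership in the signed tropical numbers 𝕋± (i.e. not balanced-nonzero). -/
def isSigned : STrop → Prop
  | elem SSign.bal _ => False
  | _ => True

/-- membership in 𝕋≥, the nonnegative tropical numbers. -/
def nneg : STrop → Prop
  | zero => True
  | elem SSign.pos _ => True
  | _ => False

/-- membership in 𝕋≤, the nonpositive tropical numbers. -/
def npos : STrop → Prop
  | zero => True
  | elem SSign.neg _ => True
  | _ => False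

/-- strictly positive signed element (sign ⊕, not 𝟘). -/
def isPos : STrop → Prop
  | elem SSign.pos _ => True
  | _ => False

/-- balanced or 𝟘 (membership in 𝕋•). -/
def balZero : STrop → Prop
  | zero => True
  | elem SSign.bal _ => True
  | _ => False

/-- the negation map ⊖. -/
def neg : STrop → STrop
  | zero => zero
  | elem SSign.pos r => elem SSign.neg r
  | elem SSign.neg r => elem SSign.pos r
  | elem SSign.bal r => elem SSign.bal r

/-- tropical addition ⊕ on 𝕊. -/
noncomputable def add : STrop → STrop → STrop
  | zero, y => y
  | x, zero => x
  | elem s r, elem t u =>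
    if r < u then elem t u
    else if u < r then elem s r
    else if s = t then elem s r
    else elem SSign.bal r

def signMul : SSign → SSign → SSign
  | SSign.pos, t => t
  | SSign.neg, SSign.pos => SSign.neg
  | SSign.neg, SSign.neg => SSign.pos
  | SSign.neg, SSign.bal => SSign.bal
  | SSign.bal, _ => SSign.bal

/-- tropical multiplication ⊙ on 𝕊. -/
def mul : STrop → STrop → STrop
  | zero, _ => zero
  | _, zero => zero
  | elem s r, elem t u => elem (signMul s t) (r + u)

/-- a ⊖ b := a ⊕ (⊖b). -/
noncomputable def sub (x y : STrop) : STrop := add x (neg y)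

/-- the tropical one, the signed element ⊕0. -/
def one : STrop := elem SSign.pos 0

/-- the absolute value |·| : 𝕊 → 𝕋≥. -/
def absS : STrop → STrop
  | zero => zero
  | elem _ r => elem SSign.pos r

/-- strict order: x > y iff x ⊖ y is a strictly positive signed element. -/
def sgt (x y : STrop) : Prop := isPos (sub x y)

/-- balance relation: x ⋈ y iff x ⊖ y is balanced or 𝟘. -/
def bal (x y : STrop) : Prop := balZero (sub x y)

/-- the relation ⊵ : x ⊵ y iff x > y or x ⋈ y. -/
def teq (x y : STrop) : Prop := sgt x y ∨ bal x y

/-- the total order ≤ on the signed tropical numbers 𝕋±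
(arbitrarily `False` whenever a balanced element is involved). -/
def sle : STrop → STrop → Prop
  | zero, zero => True
  | zero, elem SSign.pos _ => True
  | elem SSign.neg _, zero => True
  | elem SSign.neg _, elem SSign.pos _ => True
  | elem SSign.pos r, elem SSign.pos u => r ≤ u
  | elem SSign.neg r, elem SSign.neg u => u ≤ r
  | _, _ => False

/-- U(a): the set of signed numbers incomparable with a; the singleton {a}
for signed a, and the order interval [⊖|a|, |a|] for balanced a. -/
def U : STrop → Set STrop
  | elem SSign.bal r => {x | isSigned x ∧ sle (elem SSign.neg r) x ∧ sle x (elem SSign.pos r)}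
  | a => {a}

/-- tropical sum of finitely many elements of 𝕊. -/
noncomputable def sumFin : ∀ {n : ℕ}, (Fin n → STrop) → STrop
  | 0, _ => zero
  | _ + 1, f => add (f 0) (sumFin fun i => f i.succ)

/-- matrix–vector product A ⊙ x over 𝕊. -/
noncomputable def mv {d n : ℕ} (A : Fin d → Fin n → STrop) (x : Fin n → STrop) : Fin d → STrop :=
  fun i => sumFin fun j => mul (A i j) (x j)

/-- vectors in 𝕋±^d. -/
def isSignedVec {d : ℕ} (v : Fin d → STrop) : Prop := ∀ i, isSigned (v i)

/-- the signed tropical convex hull of the columns of a matrix A: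
tconv(A) = {z ∈ 𝕋±^d : z ⋈ A⊙x for some x ∈ 𝕋≥^n with ⊕_j x_j = 0}. -/
def tconv {d n : ℕ} (A : Fin d → Fin n → STrop) : Set (Fin d → STrop) :=
  {z | isSignedVec z ∧ ∃ x : Fin n → STrop,
    (∀ j, nneg (x j)) ∧ sumFin x = one ∧ ∀ i, bal (z i) (mv A x i)}

/-- the signed tropical convex hull of an arbitrary set: the union of the hulls
of all finite collections of points of M. -/
def tconvSet {d : ℕ} (M : Set (Fin d → STrop)) : Set (Fin d → STrop) :=
  ⋃ (n : ℕ) (A : Fin d → Fin n → STrop) (_ : ∀ j, (fun i => A i j) ∈ M), tconv A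

/-- a set M ⊆ 𝕋±^d is tropically convex iff M = tconv(M). -/
def TropConvex {d : ℕ} (M : Set (Fin d → STrop)) : Prop := M = tconvSet M

/-- evaluation a ⊙ (0, x₁, …, x_d)ᵀ of an affine functional. -/
noncomputable def affEval {d : ℕ} (a : Fin (d + 1) → STrop) (x : Fin d → STrop) : STrop :=
  sumFin fun j => mul (a j) ((Fin.cons one x : Fin (d + 1) → STrop) j)

/-- the open signed tropical halfspace H⁺(a) = {x ∈ 𝕋±^d : a⊙(0,x)ᵀ > 𝟘}. -/
def Hopen {d : ℕ} (a : Fin (d + 1) → STrop) : Set (Fin d → STrop) :=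
  {x | isSignedVec x ∧ sgt (affEval a x) zero}

/-- the closed signed tropical halfspace H̄⁺(a) = {x ∈ 𝕋±^d : a⊙(0,x)ᵀ ⊵ 𝟘}. -/
def Hclosed {d : ℕ} (a : Fin (d + 1) → STrop) : Set (Fin d → STrop) :=
  {x | isSignedVec x ∧ teq (affEval a x) zero}

/-- the non-negative kernel nnker(A). -/
def nnker {d n : ℕ} (A : Fin d → Fin n → STrop) : Set (Fin n → STrop) :=
  {x | (∀ j, nneg (x j)) ∧ x ≠ (fun _ => zero) ∧ ∀ i, balZero (mv A x i)}

/-- the open tropical cone sep(A) = {y ∈ 𝕋±^d : yᵀ⊙A > 𝟘 componentwise}. -/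
def sep {d : ℕ} {J : Type} (A : Fin d → J → STrop) : Set (Fin d → STrop) :=
  {y | isSignedVec y ∧ ∀ j, isPos (sumFin fun i => mul (y i) (A i j))}

end STrop


open scoped NNReal

namespace SignedTropical

/-- The largest positive part occurring in a finite real family. -/
noncomputable def posSup {ι : Type*} [Fintype ι] (t : ι → ℝ) : ℝ≥0 :=
  Finset.univ.sup fun i => (t i).toNNReal

/-- The largest negative part occurring in a finite real family. -/
noncomputable def negSup {ι : Type*} [Fintype ι] (t : ι → ℝ) : ℝ≥0 :=
  Finset.univ.sup fun i => (-t i).toNNReal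

section Sup

variable {ι : Type*} [Fintype ι]

lemma le_posSup (t : ι → ℝ) (i : ι) : t i ≤ posSup t := by
  have h : (t i).toNNReal ≤ posSup t :=
    Finset.le_sup (f := fun i => (t i).toNNReal) (Finset.mem_univ i)
  exact (Real.le_coe_toNNReal _).trans (by exact_mod_cast h)

lemma negSup_eq (t : ι → ℝ) : negSup t = posSup fun i => -t i := rfl

lemma neg_le_negSup (t : ι → ℝ) (i : ι) : -t i ≤ negSup t :=
  le_posSup (fun i => -t i) i

lemma posSup_le {t : ι → ℝ} {c : ℝ≥0} : posSup t ≤ c ↔ ∀ i, t i ≤ c := by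
  simp [posSup, Finset.sup_le_iff, Real.toNNReal_le_iff_le_coe]

lemma negSup_le {t : ι → ℝ} {c : ℝ≥0} : negSup t ≤ c ↔ ∀ i, -t i ≤ c := by
  rw [negSup_eq, posSup_le]

lemma posSup_lt {t : ι → ℝ} {c : ℝ} (hc : 0 < c) (h : ∀ i, t i < c) : (posSup t : ℝ) < c := by
  lift c to ℝ≥0 using hc.le
  have hc' : (⊥ : ℝ≥0) < c := by exact_mod_cast hc
  have : posSup t < c := by
    rw [posSup, Finset.sup_lt_iff hc']
    intro i _
    rw [← NNReal.coe_lt_coe, Real.coe_toNNReal']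
    exact max_lt (h i) hc
  exact_mod_cast this

lemma exists_eq_posSup {t : ι → ℝ} (h : 0 < posSup t) : ∃ i, t i = posSup t := by
  by_contra! hne
  have := posSup_lt (t := t) (c := posSup t) (by exact_mod_cast h)
    fun i => lt_of_le_of_ne (le_posSup t i) (hne i)
  exact lt_irrefl _ this

lemma posSup_mul (c : ℝ≥0) (t : ι → ℝ) : (posSup fun i => c * t i) = c * posSup t := by
  simp only [posSup, Real.toNNReal_mul c.coe_nonneg, Real.toNNReal_coe, NNReal.mul_finset_sup]

lemma negSup_mul (c : ℝ≥0) (t : ι → ℝ) : (negSup fun i => c * t i) = c * negSup t := by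
  simp only [negSup_eq, ← posSup_mul, mul_neg]

lemma posSup_sup_mul (x y : ι → ℝ≥0) (t : ι → ℝ) :
    (posSup fun i => ((x i ⊔ y i : ℝ≥0) : ℝ) * t i) =
      (posSup fun i => x i * t i) ⊔ posSup fun i => y i * t i := by
  simp only [posSup, ← Finset.sup_sup]
  refine Finset.sup_congr rfl fun i _ => ?_
  simp only [Real.toNNReal_mul (NNReal.coe_nonneg _), Real.toNNReal_coe, Pi.sup_apply]
  exact max_mul_of_nonneg _ _ (zero_le)

lemma negSup_sup_mul (x y : ι → ℝ≥0) (t : ι → ℝ) :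
    (negSup fun i => ((x i ⊔ y i : ℝ≥0) : ℝ) * t i) =
      (negSup fun i => x i * t i) ⊔ negSup fun i => y i * t i := by
  simp only [negSup_eq, ← mul_neg]
  exact posSup_sup_mul x y fun i => -t i

lemma posSup_succ {n : ℕ} (t : Fin (n + 1) → ℝ) :
    posSup t = (t 0).toNNReal ⊔ posSup fun i : Fin n => t i.succ := by
  simp [posSup, Fin.univ_succ, Finset.sup_map, Function.comp_def]

lemma negSup_succ {n : ℕ} (t : Fin (n + 1) → ℝ) :
    negSup t = (-t 0).toNNReal ⊔ negSup fun i : Fin n => t i.succ :=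
  posSup_succ fun i => -t i

/-- The tropical sum of the family is strictly positive. -/
def TropPos (t : ι → ℝ) : Prop := ∃ i, ∀ k, 0 < t i + t k

lemma tropPos_iff {t : ι → ℝ} : TropPos t ↔ negSup t < posSup t := by
  constructor
  · rintro ⟨i, hi⟩
    have h0 : 0 < t i := by linarith [hi i]
    have h1 : (negSup t : ℝ) < t i := by
      rw [negSup_eq]; exact posSup_lt h0 fun k => by linarith [hi k]
    exact_mod_cast h1.trans_le (le_posSup t i)
  · intro h
    obtain ⟨i, hi⟩ := exists_eq_posSup (pos_of_gt h)
    refine ⟨i, fun k => ?_⟩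
    have h1 := neg_le_negSup t k
    have h2 : (negSup t : ℝ) < posSup t := by exact_mod_cast h
    linarith

end Sup

/-- `InU u P N`: the signed number `u` is incomparable with the tropical sum of a family
whose largest positive part is `P` and whose largest negative part is `N`. -/
def InU (u P N : ℝ) : Prop :=
  -N ≤ u ∧ u ≤ P ∧ (u ≤ -N ∨ N ≤ P) ∧ (P ≤ u ∨ P ≤ N)

/-- The entry of larger absolute value, preferring the first one. -/
noncomputable def pick (a b : ℝ) : ℝ := if |b| ≤ |a| then a else b

lemma mul_pick (c a b : ℝ) : c * pick a b = pick (c * a) (c * b) := by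
  unfold pick
  rcases eq_or_ne c 0 with rfl | hc
  · simp
  · have : |c * b| ≤ |c * a| ↔ |b| ≤ |a| := by
      rw [abs_mul, abs_mul]; exact mul_le_mul_iff_right₀ (abs_pos.2 hc)
    simp only [this, mul_ite]

lemma InU.join {u v w P N P' N' : ℝ} (hu : InU u P N) (hv : InU v P' N')
    (hw : w = pick u v ∨ (w = 0 ∧ u + v = 0)) : InU w (P ⊔ P') (N ⊔ N') := by
  obtain ⟨a1, a2, a3, a4⟩ := hu
  obtain ⟨b1, b2, b3, b4⟩ := hv
  unfold InU
  rcases hw with rfl | ⟨rfl, h⟩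
  · unfold pick
    rcases le_total P P' with h1 | h1 <;> rcases le_total N N' with h2 | h2 <;>
    simp only [sup_eq_left.2, sup_eq_right.2, h1, h2] <;>
    rcases abs_cases u with ⟨h3, _⟩ | ⟨h3, _⟩ <;> rcases abs_cases v with ⟨h4, _⟩ | ⟨h4, _⟩ <;>
    rw [h3, h4] <;> split_ifs <;> refine ⟨?_, ?_, ?_, ?_⟩ <;> grind
  · rcases le_total P P' with h1 | h1 <;> rcases le_total N N' with h2 | h2 <;>
    simp only [sup_eq_left.2, sup_eq_right.2, h1, h2] <;>
    refine ⟨?_, ?_, ?_, ?_⟩ <;> grind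

lemma InU.smul {u P N c : ℝ} (hc : 0 ≤ c) (h : InU u P N) : InU (c * u) (c * P) (c * N) := by
  obtain ⟨a1, a2, a3, a4⟩ := h
  refine ⟨?_, mul_le_mul_of_nonneg_left a2 hc, ?_, ?_⟩
  · simpa using mul_le_mul_of_nonneg_left a1 hc
  · exact a3.imp (fun h => by simpa using mul_le_mul_of_nonneg_left h hc)
      fun h => mul_le_mul_of_nonneg_left h hc
  · exact a4.imp (fun h => mul_le_mul_of_nonneg_left h hc)
      fun h => mul_le_mul_of_nonneg_left h hc

lemma inU_self (a : ℝ) : InU a (a.toNNReal) ((-a).toNNReal) := by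
  rcases le_total 0 a with h | h <;>
  simp [InU, Real.coe_toNNReal', h]

lemma inU_zero {P N : ℝ≥0} (h : InU 0 P N) : P = N := by
  obtain ⟨-, -, h3, h4⟩ := h
  have hP := P.coe_nonneg
  have hN := N.coe_nonneg
  apply NNReal.eq
  rcases h3 with h3 | h3 <;> rcases h4 with h4 | h4 <;> linarith

/-- The signed tropical cone generated by `S`, presented by elementary operations. -/
inductive Gen {D : ℕ} (S : Set (Fin D → ℝ)) : (Fin D → ℝ) → Prop
  | of (u : Fin D → ℝ) (hu : u ∈ S) : Gen S u
  | smul (c : ℝ) (hc : 0 < c) (u : Fin D → ℝ) (hu : Gen S u) : Gen S fun i => c * u i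
  | join (u v w : Fin D → ℝ) (hu : Gen S u) (hv : Gen S v)
      (hw : ∀ i, w i = pick (u i) (v i) ∨ (w i = 0 ∧ u i + v i = 0)) : Gen S w

/-- Every generated vector is incomparable with a nonnegative combination of the generators. -/
lemma Gen.exists_combination {D n : ℕ} {A : Fin n → Fin D → ℝ} {u : Fin D → ℝ}
    (hu : Gen (Set.range A) u) :
    ∃ x : Fin n → ℝ≥0, x ≠ 0 ∧
      ∀ i, InU (u i) (posSup fun j => x j * A j i) (negSup fun j => x j * A j i) := by
  induction hu with
  | of u hu =>
    obtain ⟨j, rfl⟩ := hu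
    have key : ∀ f : Fin n → ℝ,
        (posSup fun k => ((Pi.single j 1 : Fin n → ℝ≥0) k : ℝ) * f k) = (f j).toNNReal := by
      intro f
      apply le_antisymm
      · rw [posSup_le]
        intro k
        rcases eq_or_ne k j with rfl | hk
        · simp
        · simp [hk]
      · rw [Real.toNNReal_le_iff_le_coe]
        have := le_posSup (fun k => ((Pi.single j 1 : Fin n → ℝ≥0) k : ℝ) * f k) j
        simpa using this
    refine ⟨Pi.single j 1, by simp, fun i => ?_⟩
    simp only [negSup_eq, ← mul_neg, key]
    exact inU_self _
  | smul c hc u _ ih =>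
    obtain ⟨x, hx, h⟩ := ih
    lift c to ℝ≥0 using hc.le
    refine ⟨fun j => c * x j, ?_, fun i => ?_⟩
    · intro h0
      apply hx
      funext j
      have := congrFun h0 j
      have hc' : c ≠ 0 := by exact_mod_cast hc.ne'
      simpa [hc'] using this
    · simp only [NNReal.coe_mul, mul_assoc, posSup_mul, negSup_mul]
      exact (h i).smul hc.le
  | join u v w _ _ hw ih ih' =>
    obtain ⟨x, hx, h⟩ := ih
    obtain ⟨y, -, h'⟩ := ih'
    refine ⟨fun j => x j ⊔ y j, ?_, fun i => ?_⟩
    · intro h0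
      apply hx
      funext j
      have := congrFun h0 j
      exact le_antisymm (le_sup_left.trans_eq this) (zero_le)
    · rw [posSup_sup_mul, negSup_sup_mul, NNReal.coe_max, NNReal.coe_max]
      exact (h i).join (h' i) (hw i)

/-- The smallest signed number incomparable with the tropical sum of the family. -/
noncomputable def lower {D : ℕ} (t : Fin D → ℝ) : ℝ :=
  if negSup t < posSup t then posSup t else -negSup t

lemma tropPos_cons {D : ℕ} {c : ℝ} {t : Fin (D + 1) → ℝ} (h0 : t 0 = c)
    (h : 0 < c + lower fun i : Fin D => t i.succ) : TropPos t := by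
  rw [tropPos_iff, posSup_succ, negSup_succ, h0, ← NNReal.coe_lt_coe]
  simp only [NNReal.coe_max, Real.coe_toNNReal']
  unfold lower at h
  have := (posSup fun i : Fin D => t i.succ).coe_nonneg
  have := (negSup fun i : Fin D => t i.succ).coe_nonneg
  split_ifs at h with hlt
  · rw [← NNReal.coe_lt_coe] at hlt
    grind
  · rw [← NNReal.coe_lt_coe] at hlt
    grind

lemma lower_pos_of_tropPos {D : ℕ} {t : Fin D → ℝ} (h : TropPos t) : 0 < lower t := by
  rw [tropPos_iff] at h
  rw [lower, if_pos h]
  exact_mod_cast pos_of_gt h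

lemma lower_mul {D : ℕ} {c : ℝ} (hc : 0 < c) (t : Fin D → ℝ) :
    (lower fun i => c * t i) = c * lower t := by
  lift c to ℝ≥0 using hc.le
  have hc' : 0 < c := by exact_mod_cast hc
  simp only [lower, posSup_mul, negSup_mul, mul_lt_mul_iff_right₀ hc']
  split_ifs <;> simp

lemma posSup_pick_le {D : ℕ} (p q : Fin D → ℝ) :
    (posSup fun i => pick (p i) (q i)) ≤ posSup p ⊔ posSup q := by
  rw [posSup_le]
  intro i
  rw [NNReal.coe_max]
  unfold pick
  split_ifs
  · exact (le_posSup p i).trans (le_max_left _ _)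
  · exact (le_posSup q i).trans (le_max_right _ _)

lemma negSup_le_negSup_pick {D : ℕ} {p q : Fin D → ℝ}
    (hP : posSup q ≤ negSup p) (hN : negSup q ≤ negSup p) :
    negSup p ≤ negSup fun i => pick (p i) (q i) := by
  rcases eq_zero_or_pos (negSup p) with h | h
  · rw [h]; exact zero_le
  obtain ⟨i, hi⟩ := exists_eq_posSup (t := fun i => -p i) h
  rw [← negSup_eq] at hi
  have h1 := le_posSup q i
  have h2 := neg_le_negSup q i
  rw [← NNReal.coe_le_coe] at hP hN
  have hle : |q i| ≤ |p i| := by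
    refine le_trans (abs_le.2 ⟨by linarith, by linarith⟩ : |q i| ≤ negSup p) ?_
    rw [← hi]; exact neg_le_abs _
  have h3 := neg_le_negSup (fun i => pick (p i) (q i)) i
  simp only [pick, if_pos hle, hi] at h3
  exact_mod_cast h3

lemma lower_add_lower_pos {D : ℕ} {p q : Fin D → ℝ}
    (h : TropPos fun i => pick (p i) (q i)) (h' : TropPos fun i => pick (q i) (p i)) :
    0 < lower p + lower q := by
  rw [tropPos_iff] at h h'
  have h1 := h.trans_le (posSup_pick_le p q)
  have h2 := h'.trans_le (posSup_pick_le q p)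
  have hmax : negSup p ⊔ negSup q < posSup p ⊔ posSup q := by
    by_contra! hle
    obtain ⟨hp, hq⟩ := sup_le_iff.1 hle
    rcases le_total (negSup p) (negSup q) with hpq | hpq
    · rw [sup_eq_right.2 hpq] at hp hq
      have := negSup_le_negSup_pick hp hpq
      exact absurd (h2.trans_le (sup_le hq hp)) (not_lt.2 this)
    · rw [sup_eq_left.2 hpq] at hp hq
      have := negSup_le_negSup_pick hq hpq
      exact absurd (h1.trans_le (sup_le hp hq)) (not_lt.2 this)
  rw [← NNReal.coe_lt_coe, NNReal.coe_max, NNReal.coe_max] at hmax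
  unfold lower
  simp only [← NNReal.coe_lt_coe]
  have := (posSup p).coe_nonneg
  have := (posSup q).coe_nonneg
  have := (negSup p).coe_nonneg
  have := (negSup q).coe_nonneg
  split_ifs <;> grind

/-- The system obtained from `S` by eliminating the first coordinate. -/
def eliminate {D : ℕ} (S : Set (Fin (D + 1) → ℝ)) : Set (Fin D → ℝ) :=
  (fun u i => u i.succ) '' {u ∈ S | u 0 = 0} ∪
    {w | ∃ u ∈ S, ∃ v ∈ S, u 0 * v 0 < 0 ∧
      w = fun i => pick (|v 0| * u i.succ) (|u 0| * v i.succ)}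

lemma finite_eliminate {D : ℕ} {S : Set (Fin (D + 1) → ℝ)} (hS : S.Finite) :
    (eliminate S).Finite := by
  refine ((hS.subset (Set.sep_subset _ _)).image _).union
    ((hS.image2 (fun u v i => pick (|v 0| * u (Fin.succ i)) (|u 0| * v i.succ)) hS).subset ?_)
  rintro w ⟨u, hu, v, hv, -, rfl⟩
  exact ⟨u, hu, v, hv, rfl⟩

lemma Gen.of_eliminate {D : ℕ} {S : Set (Fin (D + 1) → ℝ)} {w : Fin D → ℝ}
    (h : Gen (eliminate S) w) : Gen S (Fin.cons 0 w) := by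
  induction h with
  | of w hw =>
    rcases hw with ⟨u, ⟨hu, hu0⟩, rfl⟩ | ⟨u, hu, v, hv, huv, rfl⟩
    · convert Gen.of u hu using 1
      funext i
      refine Fin.cases ?_ (fun i => ?_) i <;> simp [hu0]
    · have hu0 : u 0 ≠ 0 := left_ne_zero_of_mul huv.ne
      have hv0 : v 0 ≠ 0 := right_ne_zero_of_mul huv.ne
      refine Gen.join _ _ _ (.smul |v 0| (abs_pos.2 hv0) _ (.of u hu))
        (.smul |u 0| (abs_pos.2 hu0) _ (.of v hv)) fun i => ?_
      refine Fin.cases ?_ (fun i => ?_) i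
      · right
        refine ⟨by simp, ?_⟩
        rcases mul_neg_iff.1 huv with ⟨h1, h2⟩ | ⟨h1, h2⟩
        · rw [abs_of_pos h1, abs_of_neg h2]; ring
        · rw [abs_of_neg h1, abs_of_pos h2]; ring
      · left; simp
  | smul c hc u _ ih =>
    convert Gen.smul c hc _ ih using 1
    funext i
    refine Fin.cases ?_ (fun i => ?_) i <;> simp
  | join u v w _ _ hw ih ih' =>
    refine Gen.join _ _ _ ih ih' fun i => ?_
    refine Fin.cases ?_ (fun i => ?_) i
    · simp
    · simpa using hw i

/-- Signed tropical Farkas lemma. -/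
theorem exists_separating_or_gen_zero {D : ℕ} (S : Set (Fin D → ℝ)) (hS : S.Finite) :
    (∃ y : Fin D → ℝ, ∀ u ∈ S, TropPos fun i => y i * u i) ∨ Gen S 0 := by
  induction D with
  | zero =>
    rcases S.eq_empty_or_nonempty with rfl | ⟨u, hu⟩
    · exact Or.inl ⟨0, by simp⟩
    · right
      convert Gen.of u hu
  | succ D ih =>
    rcases ih (eliminate S) (finite_eliminate hS) with ⟨y, hy⟩ | h
    · left
      let l : (Fin (D + 1) → ℝ) → ℝ := fun u => lower fun i : Fin D => y i * u i.succ
      obtain ⟨c, hc1, hc2⟩ := Order.exists_between_finsets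
        ((hS.subset (Set.sep_subset S fun u => 0 < u 0)).toFinset.image fun u => -l u / u 0)
        ((hS.subset (Set.sep_subset S fun u => u 0 < 0)).toFinset.image fun u => l u / -u 0)
        (by
          simp only [Finset.mem_image, Set.Finite.mem_toFinset, Set.mem_ofPred_eq]
          rintro _ ⟨u, ⟨hu, hu0⟩, rfl⟩ _ ⟨v, ⟨hv, hv0⟩, rfl⟩
          have hv0' : 0 < -v 0 := by linarith
          have h1 := hy _ (Or.inr ⟨u, hu, v, hv, by nlinarith, rfl⟩)
          have h2 := hy _ (Or.inr ⟨v, hv, u, hu, by nlinarith, rfl⟩)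
          simp only [mul_pick, abs_of_pos hu0, abs_of_neg hv0] at h1 h2
          have h3 := lower_add_lower_pos h1 h2
          simp only [mul_left_comm (y _) (-v 0), mul_left_comm (y _) (u 0),
            lower_mul hv0', lower_mul hu0] at h3
          rw [div_lt_div_iff₀ hu0 hv0']
          simp only [l]
          linarith)
      simp only [Finset.mem_image, Set.Finite.mem_toFinset, Set.mem_ofPred_eq,
        forall_exists_index, and_imp] at hc1 hc2
      refine ⟨Fin.cons c y, fun u hu => ?_⟩
      apply tropPos_cons (c := c * u 0) (by simp)
      simp only [Fin.cons_succ]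
      change 0 < c * u 0 + l u
      rcases lt_trichotomy (u 0) 0 with h0 | h0 | h0
      · have := hc2 _ u hu h0 rfl
        rw [lt_div_iff₀ (by linarith)] at this
        linarith
      · rw [h0, mul_zero, zero_add]
        exact lower_pos_of_tropPos (hy _ (Or.inl ⟨u, ⟨hu, h0⟩, rfl⟩))
      · have := hc1 _ u hu h0 rfl
        rw [div_lt_iff₀ h0] at this
        linarith
    · right
      convert h.of_eliminate using 1
      funext i
      refine Fin.cases ?_ (fun i => ?_) i <;> simp

end SignedTropical

namespace SignedTropical

lemma InU.neg_lt_mul {ι : Type*} [Fintype ι] {t : ι → ℝ} {z y M : ℝ}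
    (h : InU z (posSup t) (negSup t)) (hM : 0 < M) (ht : ∀ j, -M < y * t j) : -M < y * z := by
  obtain ⟨h1, h2, -, -⟩ := h
  rcases lt_trichotomy y 0 with hy | rfl | hy
  · have hy' : 0 < -y := by linarith
    have : (posSup t : ℝ) < M / -y := posSup_lt (div_pos hM hy') fun j => by
      rw [lt_div_iff₀ hy']; linarith [ht j]
    have := h2.trans_lt this
    rw [lt_div_iff₀ hy'] at this
    linarith
  · linarith
  · have : (negSup t : ℝ) < M / y := posSup_lt (div_pos hM hy) fun j => by
      rw [lt_div_iff₀ hy]; linarith [ht j]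
    have := (neg_le.1 h1).trans_lt this
    rw [lt_div_iff₀ hy] at this
    linarith

lemma InU.le_mul {ι : Type*} [Fintype ι] {t : ι → ℝ} {z y M : ℝ}
    (h : InU z (posSup t) (negSup t)) (hM : 0 < M) (ht : ∀ j, -M < y * t j) {j : ι}
    (hj : M ≤ y * t j) : M ≤ y * z := by
  obtain ⟨-, -, h3, h4⟩ := h
  rcases lt_trichotomy y 0 with hy | rfl | hy
  · have hy' : 0 < -y := by linarith
    have h1 : (posSup t : ℝ) < M / -y := posSup_lt (div_pos hM hy') fun j => by
      rw [lt_div_iff₀ hy']; linarith [ht j]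
    have h2 : M / -y ≤ negSup t := by
      refine le_trans ?_ (neg_le_negSup t j)
      rw [div_le_iff₀ hy']; linarith
    have h5 : M / -y ≤ -z := by rcases h3 with h3 | h3 <;> linarith
    rw [div_le_iff₀ hy'] at h5
    linarith
  · linarith
  · have h1 : (negSup t : ℝ) < M / y := posSup_lt (div_pos hM hy) fun j => by
      rw [lt_div_iff₀ hy]; linarith [ht j]
    have h2 : M / y ≤ posSup t := by
      refine le_trans ?_ (le_posSup t j)
      rw [div_le_iff₀ hy]; linarith
    have h5 : M / y ≤ z := by rcases h4 with h4 | h4 <;> linarith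
    rw [div_le_iff₀ hy] at h5
    linarith

/-- An open halfspace containing all generators contains their signed tropical cone. -/
lemma tropPos_of_combination {D n : ℕ} {A : Fin n → Fin D → ℝ} {y z : Fin D → ℝ} {x : Fin n → ℝ≥0}
    (hx : x ≠ 0) (hy : ∀ j, TropPos fun i => y i * A j i)
    (hz : ∀ i, InU (z i) (posSup fun j => x j * A j i) (negSup fun j => x j * A j i)) :
    TropPos fun i => y i * z i := by
  obtain ⟨j₀, hj₀⟩ := Function.ne_iff.1 hx
  have hj₀' : (0 : ℝ) < x j₀ := by exact_mod_cast pos_iff_ne_zero.2 hj₀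
  obtain ⟨i₀, hi₀⟩ := hy j₀
  have : Nonempty (Fin D × Fin n) := ⟨(i₀, j₀)⟩
  obtain ⟨⟨i, j⟩, hmax⟩ := Finite.exists_max fun p : Fin D × Fin n => y p.1 * (x p.2 * A p.2 p.1)
  simp only [Prod.forall] at hmax
  set M := y i * (x j * A j i) with hMdef
  have hM : 0 < M := by
    refine lt_of_lt_of_le ?_ (hmax i₀ j₀)
    have := hi₀ i₀
    rw [mul_left_comm]
    exact mul_pos hj₀' (by linarith)
  have hlow : ∀ k l, -M < y k * (x l * A l k) := by
    intro k l
    rcases eq_or_ne (x l) 0 with h0 | h0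
    · simp [h0, hM]
    · have h0' : (0 : ℝ) < x l := by exact_mod_cast pos_iff_ne_zero.2 h0
      obtain ⟨i', hi'⟩ := hy l
      have h1 := mul_pos h0' (hi' k)
      have h2 := hmax i' l
      linarith
  refine ⟨i, fun k => ?_⟩
  have h1 := (hz i).le_mul hM (hlow i) (j := j) le_rfl
  have h2 := (hz k).neg_lt_mul hM (hlow k)
  linarith

/-- Combinatorial types of separating functionals: the signs of the coefficients, the
dominating index for each generator, and the dominating index for the separated point. -/
abbrev SepType (D n : ℕ) : Type := (Fin D → SignType) × (Fin n → Fin D) × Fin D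

/-- Absolute values of the normalized functionals of a given type
that are strictly positive on the generators. -/
def sepSet {D n : ℕ} (A : Fin n → Fin D → ℝ) (τ : SepType D n) : Set (Fin D → ℝ) :=
  {η | (∀ i, 0 ≤ η i) ∧ η τ.2.2 = 1 ∧
    ∀ j k, 0 < τ.1 (τ.2.1 j) * η (τ.2.1 j) * A j (τ.2.1 j) + τ.1 k * η k * A j k}

lemma inf_mem_sepSet {D n : ℕ} {A : Fin n → Fin D → ℝ} {τ : SepType D n} {η θ : Fin D → ℝ}
    (hη : η ∈ sepSet A τ) (hθ : θ ∈ sepSet A τ) : η ⊓ θ ∈ sepSet A τ := by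
  have key : ∀ a b p p' q q' : ℝ, 0 ≤ q → 0 ≤ q' → 0 < a * p + a * p → 0 < a * p' + a * p' →
      0 < a * p + b * q → 0 < a * p' + b * q' → 0 < a * (p ⊓ p') + b * (q ⊓ q') := by
    intro a b p p' q q' hq hq' h1 h2 h3 h4
    rcases le_total 0 b with hb | hb
    · have := mul_nonneg hb (le_inf hq hq')
      rcases min_choice p p' with h | h <;> rw [h] <;> linarith
    · have h5 := mul_le_mul_of_nonpos_left (min_le_left q q') hb
      have h6 := mul_le_mul_of_nonpos_left (min_le_right q q') hb
      rcases min_choice p p' with h | h <;> rw [h] <;> linarith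
  obtain ⟨a1, a2, a3⟩ := hη
  obtain ⟨b1, b2, b3⟩ := hθ
  refine ⟨fun i => le_inf (a1 i) (b1 i), by simp [a2, b2], fun j k => ?_⟩
  have e1 := a3 j (τ.2.1 j)
  have e2 := b3 j (τ.2.1 j)
  have e3 := a3 j k
  have e4 := b3 j k
  have := key (τ.1 (τ.2.1 j) * A j (τ.2.1 j)) (τ.1 k * A j k) (η (τ.2.1 j)) (θ (τ.2.1 j))
    (η k) (θ k) (a1 k) (b1 k) (by linarith) (by linarith) (by linarith) (by linarith)
  simp only [Pi.inf_apply]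
  linarith

/-- The coordinatewise infimum of `sepSet`. -/
noncomputable def sepInf {D n : ℕ} (A : Fin n → Fin D → ℝ) (τ : SepType D n) (i : Fin D) : ℝ :=
  sInf ((fun η => η i) '' sepSet A τ)

lemma sepInf_le {D n : ℕ} {A : Fin n → Fin D → ℝ} {τ : SepType D n} {η : Fin D → ℝ}
    (hη : η ∈ sepSet A τ) (i : Fin D) : sepInf A τ i ≤ η i :=
  csInf_le ⟨0, by rintro _ ⟨θ, hθ, rfl⟩; exact hθ.1 i⟩ ⟨η, hη, rfl⟩

lemma sepInf_nonneg {D n : ℕ} (A : Fin n → Fin D → ℝ) (τ : SepType D n) (i : Fin D) :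
    0 ≤ sepInf A τ i :=
  Real.sInf_nonneg (by rintro _ ⟨θ, hθ, rfl⟩; exact hθ.1 i)

lemma sepInf_dominating {D n : ℕ} {A : Fin n → Fin D → ℝ} {τ : SepType D n}
    (hne : (sepSet A τ).Nonempty) : sepInf A τ τ.2.2 = 1 := by
  have : (fun η : Fin D → ℝ => η τ.2.2) '' sepSet A τ = {1} := by
    apply Set.eq_singleton_iff_nonempty_unique_mem.2
    exact ⟨hne.image _, by rintro _ ⟨θ, hθ, rfl⟩; exact hθ.2.1⟩
  rw [sepInf, this, csInf_singleton]

lemma sepInf_mem_closure {D n : ℕ} {A : Fin n → Fin D → ℝ} {τ : SepType D n}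
    (hne : (sepSet A τ).Nonempty) : sepInf A τ ∈ closure (sepSet A τ) := by
  rw [Metric.mem_closure_iff]
  intro ε hε
  have hex : ∀ i, ∃ η ∈ sepSet A τ, η i < sepInf A τ i + ε := by
    intro i
    obtain ⟨_, ⟨η, hη, rfl⟩, h⟩ := exists_lt_of_csInf_lt (hne.image fun η => η i)
      (lt_add_of_pos_right (sepInf A τ i) hε)
    exact ⟨η, hη, h⟩
  choose f hf hlt using hex
  have hfin : ∀ s : Finset (Fin D), ∃ η ∈ sepSet A τ, ∀ i ∈ s, η i < sepInf A τ i + ε := by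
    intro s
    induction s using Finset.induction_on with
    | empty => exact ⟨hne.some, hne.some_mem, by simp⟩
    | insert a s _ ih =>
      obtain ⟨η, hη, h⟩ := ih
      refine ⟨η ⊓ f a, inf_mem_sepSet hη (hf a), fun i hi => ?_⟩
      rcases Finset.mem_insert.1 hi with rfl | hi
      · exact (min_le_right _ _).trans_lt (hlt i)
      · exact (min_le_left _ _).trans_lt (h i hi)
  obtain ⟨η, hη, h⟩ := hfin Finset.univ
  refine ⟨η, hη, (dist_pi_lt_iff hε).2 fun i => ?_⟩
  rw [Real.dist_eq, abs_lt]
  have h1 := h i (Finset.mem_univ i)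
  have h2 := sepInf_le hη i
  constructor <;> linarith

/-- The limit functional of a given type. -/
noncomputable def sepFunctional {D n : ℕ} (A : Fin n → Fin D → ℝ) (τ : SepType D n) :
    Fin D → ℝ := fun i => τ.1 i * sepInf A τ i

lemma not_tropPos_neg_sepFunctional {D n : ℕ} {A : Fin n → Fin D → ℝ} {τ : SepType D n}
    (hne : (sepSet A τ).Nonempty) {z : Fin D → ℝ} {x : Fin n → ℝ≥0} (hx : x ≠ 0)
    (hz : ∀ i, InU (z i) (posSup fun j => x j * A j i) (negSup fun j => x j * A j i)) :
    ¬ TropPos fun i => -(sepFunctional A τ i * z i) := by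
  rintro ⟨i, hi⟩
  have hopen : IsOpen {η : Fin D → ℝ |
      ∀ k, 0 < -(τ.1 i * η i * z i) + -(τ.1 k * η k * z k)} := by
    simp only [Set.ofPred_forall]
    exact isOpen_iInter_of_finite fun k => isOpen_lt (by fun_prop) (by fun_prop)
  obtain ⟨η, hη, hmem⟩ := mem_closure_iff.1 (sepInf_mem_closure hne) _ hopen hi
  have hpos := tropPos_of_combination (y := fun i => τ.1 i * η i) hx
    (fun j => ⟨τ.2.1 j, hmem.2.2 j⟩) hz
  obtain ⟨l, hl⟩ := hpos
  have h1 := hη l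
  have h2 := hl i
  linarith

lemma exists_sepFunctional {D n : ℕ} {A : Fin n → Fin D → ℝ} {y z : Fin D → ℝ}
    (hy : ∀ j, TropPos fun i => y i * A j i) (hz : TropPos fun i => y i * -z i) :
    ∃ τ : SepType D n, (sepSet A τ).Nonempty ∧
      TropPos fun i => -(sepFunctional A τ i * z i) := by
  choose c hc using hy
  obtain ⟨i₀, hi₀⟩ := hz
  have hy0 : y i₀ ≠ 0 := by
    intro h
    have := hi₀ i₀
    simp [h] at this
  have hr : 0 < |y i₀|⁻¹ := inv_pos.2 (abs_pos.2 hy0)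
  have hsign : ∀ i, (SignType.sign (y i) : ℝ) * (|y i₀|⁻¹ * |y i|) = |y i₀|⁻¹ * y i := by
    intro i
    rw [mul_left_comm, sign_mul_abs]
  have hη : (fun i => |y i₀|⁻¹ * |y i|) ∈ sepSet A (fun i => SignType.sign (y i), c, i₀) := by
    refine ⟨fun i => by positivity, inv_mul_cancel₀ (abs_pos.2 hy0).ne', fun j k => ?_⟩
    simp only [hsign]
    have := mul_pos hr (hc j k)
    linarith
  refine ⟨_, ⟨_, hη⟩, i₀, fun k => ?_⟩
  have h1 := sepInf_dominating ⟨_, hη⟩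
  simp only at h1
  simp only [sepFunctional, h1, mul_one]
  have h2 := sepInf_le hη k
  have h3 := sepInf_nonneg A (fun i => SignType.sign (y i), c, i₀) k
  have h4 := mul_pos hr (hi₀ k)
  have h5 := mul_pos hr (hi₀ i₀)
  have e1 := hsign i₀
  rw [inv_mul_cancel₀ (abs_pos.2 hy0).ne', mul_one] at e1
  have e2 := hsign k
  set s : ℝ := (SignType.sign (y k) : ℝ)
  set q := sepInf A (fun i => SignType.sign (y i), c, i₀) k
  rw [e1]
  rcases le_total 0 (s * z k) with h | h
  · have := mul_le_mul_of_nonneg_left h2 h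
    have e3 : |y i₀|⁻¹ * (y k * -z k) = - (s * z k * (|y i₀|⁻¹ * |y k|)) := by
      linear_combination (z k) * e2
    linarith
  · have := mul_nonneg (neg_nonneg.2 h) h3
    linarith

/-- The dehomogenized hull: `z` balances a combination of the generators. -/
def Balances {D n : ℕ} (A : Fin n → Fin D → ℝ) (z : Fin D → ℝ) : Prop :=
  ∃ x : Fin n → ℝ≥0, ∀ i,
    (z i).toNNReal ⊔ negSup (fun j => x j * A j i) =
      (-z i).toNNReal ⊔ posSup (fun j => x j * A j i)

lemma inU_of_balanced {z : ℝ} {P N : ℝ≥0} (h : z.toNNReal ⊔ N = (-z).toNNReal ⊔ P) :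
    InU z P N := by
  have h' := congrArg ((↑) : ℝ≥0 → ℝ) h
  simp only [NNReal.coe_max, Real.coe_toNNReal'] at h'
  have := P.coe_nonneg
  have := N.coe_nonneg
  refine ⟨?_, ?_, ?_, ?_⟩ <;> grind

lemma balances_of_gen_zero {d n : ℕ} {A : Fin n → Fin (d + 1) → ℝ} {z : Fin (d + 1) → ℝ}
    (hA : ∀ j, A j 0 = 1)
    (h : Gen (Set.range (Fin.cons (fun i => -z i) A : Fin (n + 1) → Fin (d + 1) → ℝ)) 0) :
    Balances A z := by
  obtain ⟨x, hx, hbal⟩ := h.exists_combination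
  have heq := fun i => inU_zero (hbal i)
  simp only [posSup_succ, negSup_succ, Fin.cons_zero, Fin.cons_succ, mul_neg, neg_neg] at heq
  have hx0 : x 0 ≠ 0 := by
    intro h0
    have h1 := heq 0
    have hneg : (negSup fun j : Fin n => x j.succ * A j 0) = 0 := by
      rw [← nonpos_iff_eq_zero, negSup_le]
      intro j
      simp [hA]
    simp only [h0, hneg] at h1
    simp only [NNReal.coe_zero, zero_mul, neg_zero, Real.toNNReal_zero, max_self] at h1
    apply hx
    funext j
    refine Fin.cases h0 (fun j => ?_) j
    have h2 := le_posSup (fun j : Fin n => x j.succ * A j 0) j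
    have h3 : (posSup fun j : Fin n => x j.succ * A j 0) = 0 :=
      le_antisymm (le_sup_right.trans_eq h1) zero_le
    rw [h3, hA, mul_one] at h2
    exact le_antisymm (by exact_mod_cast h2) zero_le
  refine ⟨fun j => (x 0)⁻¹ * x j.succ, fun i => ?_⟩
  have h1 := congrArg (fun c => (x 0)⁻¹ * c) (heq i)
  simp only [← mul_neg, Real.toNNReal_mul (x 0).coe_nonneg, Real.toNNReal_coe, mul_max,
    inv_mul_cancel_left₀ hx0] at h1
  simp only [NNReal.coe_mul, mul_assoc, posSup_mul, negSup_mul]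
  exact h1.symm

/-- Real form of the exterior description of a signed tropical hull. -/
theorem balances_iff {d n : ℕ} {A : Fin n → Fin (d + 1) → ℝ} {z : Fin (d + 1) → ℝ}
    (hA : ∀ j, A j 0 = 1) (hz : z 0 = 1) :
    Balances A z ↔ ∀ τ : SepType (d + 1) n, (sepSet A τ).Nonempty →
      ¬ TropPos fun i => -(sepFunctional A τ i * z i) := by
  constructor
  · rintro ⟨x, hx⟩ τ hτ
    refine not_tropPos_neg_sepFunctional hτ (x := x) ?_ fun i => inU_of_balanced (hx i)
    rintro rfl
    have := hx 0
    have h1 : (-1 : ℝ).toNNReal = 0 := Real.toNNReal_of_nonpos (by norm_num)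
    simp [hz, posSup, negSup, h1] at this
  · intro h
    rcases exists_separating_or_gen_zero
      (Set.range (Fin.cons (fun i => -z i) A : Fin (n + 1) → Fin (d + 1) → ℝ))
      (Set.finite_range _) with ⟨y, hy⟩ | h0
    · obtain ⟨τ, hτ, hpos⟩ := exists_sepFunctional (A := A) (y := y) (z := z)
        (fun j => by simpa using hy _ ⟨j.succ, rfl⟩) (by simpa using hy _ ⟨0, rfl⟩)
      exact absurd hpos (h τ hτ)
    · exact balances_of_gen_zero hA h0

end SignedTropical

namespace SignedTropical

open STrop

/-- The real number representing a signed tropical number; balanced elements are sent to `0`. -/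
noncomputable def toReal : STrop → ℝ
  | elem SSign.pos r => Real.exp r
  | elem SSign.neg r => -Real.exp r
  | _ => 0

/-- The signed tropical number represented by a real number. -/
noncomputable def ofReal (x : ℝ) : STrop :=
  if x = 0 then zero
  else if 0 < x then elem SSign.pos (Real.log x) else elem SSign.neg (Real.log (-x))

lemma isSigned_ofReal (x : ℝ) : isSigned (ofReal x) := by
  unfold ofReal
  split_ifs <;> trivial

lemma toReal_ofReal (x : ℝ) : toReal (ofReal x) = x := by
  unfold ofReal
  split_ifs with h0 hpos
  · exact h0.symm
  · exact Real.exp_log hpos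
  · have hneg : x < 0 := lt_of_le_of_ne (not_lt.1 hpos) h0
    rw [toReal, Real.exp_log (neg_pos.2 hneg), neg_neg]

lemma nneg_ofReal {x : ℝ} (hx : 0 ≤ x) : nneg (ofReal x) := by
  unfold ofReal
  split_ifs with h0 hpos
  · trivial
  · trivial
  · exact absurd (lt_of_le_of_ne hx (Ne.symm h0)) hpos

lemma nneg.isSigned {x : STrop} (hx : nneg x) : isSigned x := by
  rcases x with _ | ⟨_ | _ | _, r⟩ <;> simp_all [nneg, STrop.isSigned]

lemma nneg.toReal_nonneg {x : STrop} (hx : nneg x) : 0 ≤ toReal x := by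
  rcases x with _ | ⟨_ | _ | _, r⟩ <;> simp_all [nneg, toReal, Real.exp_nonneg]

lemma toReal_one : toReal one = 1 := by simp [one, toReal]

lemma isSigned_mul {x y : STrop} (hx : isSigned x) (hy : isSigned y) : isSigned (mul x y) := by
  rcases x with _ | ⟨_ | _ | _, r⟩ <;> rcases y with _ | ⟨_ | _ | _, u⟩ <;>
    simp_all [isSigned, mul, signMul]

lemma toReal_mul {x y : STrop} (hx : isSigned x) (hy : isSigned y) :
    toReal (mul x y) = toReal x * toReal y := by
  rcases x with _ | ⟨_ | _ | _, r⟩ <;> rcases y with _ | ⟨_ | _ | _, u⟩ <;>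
    simp_all [isSigned, toReal, mul, signMul, Real.exp_add]

/-- `Represents x P N`: the element `x` is the tropical sum of a family
whose largest positive part is `P` and whose largest negative part is `N`. -/
def Represents : STrop → ℝ≥0 → ℝ≥0 → Prop
  | zero, P, N => P = 0 ∧ N = 0
  | elem SSign.pos r, P, N => (P : ℝ) = Real.exp r ∧ N < P
  | elem SSign.neg r, P, N => (N : ℝ) = Real.exp r ∧ P < N
  | elem SSign.bal r, P, N => (P : ℝ) = Real.exp r ∧ P = N

lemma represents_toReal {x : STrop} (hx : isSigned x) :
    Represents x (toReal x).toNNReal (-toReal x).toNNReal := by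
  rcases x with _ | ⟨_ | _ | _, r⟩
  · simp [Represents, toReal]
  · simp [Represents, toReal, Real.exp_nonneg, Real.exp_pos, Real.toNNReal_of_nonpos]
  · simp [Represents, toReal, Real.exp_nonneg, Real.exp_pos, Real.toNNReal_of_nonpos]
  · exact hx.elim

lemma Represents.neg {x : STrop} {P N : ℝ≥0} (h : Represents x P N) :
    Represents (neg x) N P := by
  rcases x with _ | ⟨_ | _ | _, r⟩ <;> simp_all [Represents, STrop.neg]
  rw [← h.2, h.1]

lemma Represents.add {x y : STrop} {P N P' N' : ℝ≥0} (h : Represents x P N)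
    (h' : Represents y P' N') : Represents (add x y) (P ⊔ P') (N ⊔ N') := by
  rcases x with _ | ⟨s, r⟩
  · obtain ⟨rfl, rfl⟩ := h
    simpa [STrop.add] using h'
  rcases y with _ | ⟨t, u⟩
  · obtain ⟨rfl, rfl⟩ := h'
    simpa [STrop.add] using h
  simp only [STrop.add]
  have hlt : r < u ↔ Real.exp r < Real.exp u := Real.exp_lt_exp.symm
  have hgt : u < r ↔ Real.exp u < Real.exp r := Real.exp_lt_exp.symm
  simp only [hlt, hgt]
  rcases s with _ | _ | _ <;> rcases t with _ | _ | _ <;> split_ifs <;>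
    simp only [Represents, ← NNReal.coe_lt_coe, ← NNReal.coe_inj, NNReal.coe_max] at h h' ⊢ <;>
    grind

lemma Represents.isPos_or_balZero_iff {x : STrop} {P N : ℝ≥0} (h : Represents x P N) :
    (isPos x ∨ balZero x) ↔ N ≤ P := by
  rcases x with _ | ⟨_ | _ | _, r⟩ <;> simp only [Represents, isPos, balZero] at h ⊢ <;>
    simp [h.2, h.2.le]

lemma Represents.balZero_iff {x : STrop} {P N : ℝ≥0} (h : Represents x P N) :
    balZero x ↔ P = N := by
  rcases x with _ | ⟨_ | _ | _, r⟩ <;> simp only [Represents, balZero] at h ⊢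
  · simp [h.1, h.2]
  · simp [h.2.ne']
  · simp [h.2.ne]
  · simp [h.2]

lemma Represents.eq_one_iff {x : STrop} {P : ℝ≥0} (h : Represents x P 0) : x = one ↔ P = 1 := by
  rcases x with _ | ⟨_ | _ | _, r⟩ <;> simp only [Represents, one] at h ⊢
  · simp [h.1]
  · rw [← NNReal.coe_inj, h.1]; simp
  · simp at h
  · obtain ⟨h1, rfl⟩ := h
    exact absurd h1 (by simpa using (Real.exp_pos r).ne)

lemma represents_sumFin {n : ℕ} {f : Fin n → STrop} (hf : ∀ i, isSigned (f i)) :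
    Represents (sumFin f) (posSup fun i => toReal (f i)) (negSup fun i => toReal (f i)) := by
  induction n with
  | zero => simp [sumFin, Represents, posSup, negSup]
  | succ n ih =>
    rw [posSup_succ, negSup_succ]
    exact (represents_toReal (hf 0)).add (ih fun i => hf i.succ)

lemma sub_zero_right (x : STrop) : sub x zero = x := by
  rcases x with _ | _ <;> rfl

lemma mem_Hclosed_iff {d : ℕ} {a : Fin (d + 1) → STrop} (ha : ∀ i, isSigned (a i))
    {x : Fin d → STrop} (hx : isSignedVec x) :
    x ∈ Hclosed a ↔
      ¬ TropPos fun i =>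
        -(toReal (a i) * (Fin.cons 1 fun i => toReal (x i) : Fin (d + 1) → ℝ) i) := by
  have hs : ∀ i, isSigned ((Fin.cons one x : Fin (d + 1) → STrop) i) :=
    Fin.cases trivial hx
  have hrep := represents_sumFin fun i => isSigned_mul (ha i) (hs i)
  have hcons : ∀ i, toReal ((Fin.cons one x : Fin (d + 1) → STrop) i) =
      (Fin.cons 1 fun i => toReal (x i) : Fin (d + 1) → ℝ) i :=
    Fin.cases toReal_one fun i => rfl
  simp only [toReal_mul (ha _) (hs _), hcons] at hrep
  rw [tropPos_iff, not_lt, ← negSup_eq]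
  simp only [negSup_eq, neg_neg] at hrep ⊢
  rw [← hrep.isPos_or_balZero_iff]
  simp only [Hclosed, teq, sgt, bal, sub_zero_right]
  exact and_iff_right hx

lemma mem_tconv_iff {d n : ℕ} {V : Fin d → Fin n → STrop} (hV : ∀ i j, isSigned (V i j))
    {z : Fin d → STrop} (hz : isSignedVec z) :
    z ∈ tconv V ↔ Balances
      (fun j => Fin.cons 1 fun i => toReal (V i j) : Fin n → Fin (d + 1) → ℝ)
      (Fin.cons 1 fun i => toReal (z i)) := by
  have hsum : ∀ x : Fin n → STrop, (∀ j, nneg (x j)) →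
      (sumFin x = one ↔ (posSup fun j => toReal (x j)) = 1) := by
    intro x hx
    have hrep := represents_sumFin fun j => nneg.isSigned (hx j)
    have h0 : (negSup fun j => toReal (x j)) = 0 := by
      rw [← nonpos_iff_eq_zero, negSup_le]
      intro j
      simpa using nneg.toReal_nonneg (hx j)
    rw [h0] at hrep
    exact hrep.eq_one_iff
  have hbal : ∀ x : Fin n → STrop, (∀ j, nneg (x j)) → ∀ i, (bal (z i) (mv V x i) ↔
      (toReal (z i)).toNNReal ⊔ negSup (fun j => toReal (x j) * toReal (V i j)) =
        (-toReal (z i)).toNNReal ⊔ posSup (fun j => toReal (x j) * toReal (V i j))) := by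
    intro x hx i
    have hrep := represents_sumFin fun j => isSigned_mul (hV i j) (nneg.isSigned (hx j))
    simp only [toReal_mul (hV i _) (nneg.isSigned (hx _)), mul_comm (toReal (V i _))] at hrep
    exact ((represents_toReal (hz i)).add hrep.neg).balZero_iff
  have hrow : ∀ x : Fin n → ℝ≥0,
      ((1 : ℝ).toNNReal ⊔ negSup (fun j => (x j : ℝ) * 1) =
        (-1 : ℝ).toNNReal ⊔ posSup (fun j => (x j : ℝ) * 1)) ↔ (posSup fun j => (x j : ℝ)) = 1 := by
    intro x
    have h0 : (negSup fun j => (x j : ℝ)) = 0 := by simp [negSup]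
    have h1 : (-1 : ℝ).toNNReal = 0 := Real.toNNReal_of_nonpos (by norm_num)
    simp [h0, h1, eq_comm]
  constructor
  · rintro ⟨-, x, hx, hone, hb⟩
    have hc : ∀ j, ((toReal (x j)).toNNReal : ℝ) = toReal (x j) := fun j =>
      Real.coe_toNNReal _ (nneg.toReal_nonneg (hx j))
    refine ⟨fun j => (toReal (x j)).toNNReal, Fin.cases ?_ fun i => ?_⟩
    · simp only [Fin.cons_zero]
      rw [hrow]
      simpa only [hc] using (hsum x hx).1 hone
    · simpa only [Fin.cons_succ, hc] using (hbal x hx i).1 (hb i)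
  · rintro ⟨x, hb⟩
    have hx : ∀ j, nneg (ofReal (x j)) := fun j => nneg_ofReal (x j).coe_nonneg
    refine ⟨hz, fun j => ofReal (x j), hx, ?_, fun i => ?_⟩
    · rw [hsum _ hx]
      simp only [toReal_ofReal]
      have := hb 0
      simp only [Fin.cons_zero] at this
      exact (hrow x).1 this
    · rw [hbal _ hx]
      simpa only [toReal_ofReal, Fin.cons_succ] using hb i.succ

end SignedTropical

/-- signed Minkowski–Weyl, exterior direction: the hull of finitely
many points is a finite intersection of closed signed tropical halfspaces. -/
theorem signed_minkowski_weyl_exterior (d n : ℕ) (V : Fin d → Fin n → STrop)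
    (hV : ∀ i j, STrop.isSigned (V i j)) :
    ∃ (m : ℕ) (a : Fin m → Fin (d + 1) → STrop),
      (∀ k l, STrop.isSigned (a k l)) ∧
      STrop.tconv V = ⋂ k, STrop.Hclosed (a k) := by
  classical
  open SignedTropical in
  let A : Fin n → Fin (d + 1) → ℝ := fun j => Fin.cons 1 fun i => toReal (V i j)
  let T := {τ : SepType (d + 1) n // (sepSet A τ).Nonempty}
  -- `none` stands for the trivial halfspace, so that the intersection contains signed points only
  let b : Option T → Fin (d + 1) → ℝ := fun o => o.elim 0 fun τ => sepFunctional A τ.1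
  let e := Fintype.equivFin (Option T)
  refine ⟨Fintype.card (Option T), fun k l => ofReal (b (e.symm k) l),
    fun k l => isSigned_ofReal _, ?_⟩
  rw [e.symm.surjective.iInter_comp (g := fun o => STrop.Hclosed fun l => ofReal (b o l))]
  ext z
  by_cases hz : STrop.isSignedVec z
  · rw [mem_tconv_iff hV hz, balances_iff (fun j => rfl) rfl]
    simp only [Set.mem_iInter, mem_Hclosed_iff (fun l => isSigned_ofReal _) hz, toReal_ofReal]
    constructor
    · rintro h (_ | τ)
      · rintro ⟨i, hi⟩
        simpa [b] using hi i
      · exact h τ.1 τ.2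
    · exact fun h τ hτ => h (some ⟨τ, hτ⟩)
  · exact ⟨fun h => absurd h.1 hz, fun h => absurd (Set.mem_iInter.1 h none).1 hz⟩
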